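/- arXiv:2505.03050 — 2 statements merged into one kernel-verified Lean document; each statement's English description precedes it below -/
import Mathlib

section
/- Let f : ℝⁿ → ℝ be C¹ with L-Lipschitz gradient on all of ℝⁿ, let ν ∈ (0,1), τ₂ ≤ ν/(L(ν+1)), and τ₁ > 0 with max{Lτ₁, 2Lτ₁δ̄ + (Lτ₁+1)β̄²} < 1 − ν, and let (x^k) be the extragradient-with-momentum (EGm) iterates: x⁰ = x¹ ∈ ℝⁿ, x^k_in := x^k + β_k(x^k − x^{k−1}), x^k_ex := x^k + γ_k(x^k − x^{k−1}), x^{k+1} := x^k_in − τ₁∇f(x^k_ex − τ₂∇f(x^k_ex)), where (β_k), (γ_k) are nonnegative with β̄ := sup β_k < 1 and δ̄ := sup|β_k − γ_k| < ∞. If inf_k f(x^k) > −∞, then ∇f(x^k) → 0; if in addition ∇f(x^k_ex) ≠ 0 for all k and f satisfies the PLK condition at an accumulation point x̄ of (x^k), then x^k → x̄ and ∇f(x̄) = 0. -/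
open Set Filter

/-- The Polyak–Łojasiewicz–Kurdyka (PLK) condition for `f` at `x₀`. -/
def PLKCondition {n : ℕ} (f : EuclideanSpace ℝ (Fin n) → ℝ)
    (x₀ : EuclideanSpace ℝ (Fin n)) : Prop :=
  ∃ (η : ℝ) (U : Set (EuclideanSpace ℝ (Fin n))) (φ : ℝ → ℝ),
    0 < η ∧ U ∈ nhds x₀ ∧ φ 0 = 0 ∧
    (∀ t ∈ Set.Ico (0:ℝ) η, 0 ≤ φ t) ∧
    ConcaveOn ℝ (Set.Ico 0 η) φ ∧
    (∀ t ∈ Set.Ioo (0:ℝ) η, HasDerivAt φ (deriv φ t) t) ∧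
    ContinuousOn (deriv φ) (Set.Ioo 0 η) ∧
    (∀ t ∈ Set.Ioo (0:ℝ) η, 0 < deriv φ t) ∧
    ∀ x ∈ U, f x₀ < f x → f x < f x₀ + η →
      1 ≤ deriv φ (f x - f x₀) * ‖gradient f x‖

section Descent

variable {E : Type*} [NormedAddCommGroup E] [InnerProductSpace ℝ E]

theorem le_add_inner_add_sq_of_lipschitz_gradient [CompleteSpace E]
    {f : E → ℝ} {G : E → E} {L : ℝ}
    (hG : ∀ x, HasGradientAt f (G x) x) (hlip : ∀ x y, ‖G x - G y‖ ≤ L * ‖x - y‖) (x y : E) :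
    f y ≤ f x + inner ℝ (G x) (y - x) + L / 2 * ‖y - x‖ ^ 2 := by
  have hline : ∀ t : ℝ, HasDerivAt (fun t : ℝ => f (x + t • (y - x)))
      (inner ℝ (G (x + t • (y - x))) (y - x)) t := by
    intro t
    have h1 : HasDerivAt (fun t : ℝ => x + t • (y - x)) (y - x) t := by
      simpa using ((hasDerivAt_id t).smul_const (y - x)).const_add x
    have h2 := (hG (x + t • (y - x))).hasFDerivAt.comp_hasDerivAt t h1
    rwa [InnerProductSpace.toDual_apply_apply] at h2
  have hquad : ∀ t : ℝ, HasDerivAt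
      (fun t : ℝ => f x + t * inner ℝ (G x) (y - x) + t ^ 2 * (L / 2 * ‖y - x‖ ^ 2))
      (inner ℝ (G x) (y - x) + t * L * ‖y - x‖ ^ 2) t := by
    intro t
    have h1 := (((hasDerivAt_id t).mul_const (inner ℝ (G x) (y - x))).const_add (f x)).add
      ((hasDerivAt_pow 2 t).mul_const (L / 2 * ‖y - x‖ ^ 2))
    exact h1.congr_deriv (by push_cast; ring)
  have key := image_le_of_deriv_right_le_deriv_boundary (a := 0) (b := 1)
    (fun t _ => (hline t).continuousAt.continuousWithinAt)
    (fun t _ => (hline t).hasDerivWithinAt) (by simp)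
    (fun t _ => (hquad t).continuousAt.continuousWithinAt)
    (fun t _ => (hquad t).hasDerivWithinAt)
    (fun t ht => by
      have h1 : inner ℝ (G (x + t • (y - x)) - G x) (y - x) ≤ t * L * ‖y - x‖ ^ 2 := by
        refine (real_inner_le_norm _ _).trans ?_
        have h2 := hlip (x + t • (y - x)) x
        rw [add_sub_cancel_left, norm_smul, Real.norm_of_nonneg ht.1] at h2
        nlinarith [mul_le_mul_of_nonneg_right h2 (norm_nonneg (y - x))]
      rw [inner_sub_left] at h1
      linarith)
    (right_mem_Icc.2 zero_le_one)
  simpa using key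

theorem add_inner_le_add_sq_of_lipschitz_gradient [CompleteSpace E]
    {f : E → ℝ} {G : E → E} {L : ℝ}
    (hG : ∀ x, HasGradientAt f (G x) x) (hlip : ∀ x y, ‖G x - G y‖ ≤ L * ‖x - y‖) (x y : E) :
    f x + inner ℝ (G x) (y - x) ≤ f y + L / 2 * ‖y - x‖ ^ 2 := by
  have hneg : ∀ x, HasGradientAt (fun x => -f x) (-G x) x := fun x => by
    rw [hasGradientAt_iff_hasFDerivAt, map_neg]
    exact (hG x).hasFDerivAt.neg
  have h := le_add_inner_add_sq_of_lipschitz_gradient hneg (L := L)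
    (fun x y => by rw [← norm_neg]; simpa [sub_eq_add_neg, add_comm] using hlip x y) x y
  rw [inner_neg_left] at h
  linarith

/-- The look-ahead gradient approximates the gradient with relative error `ν`. -/
theorem norm_gradient_sub_lookahead_le {G : E → E} {L ν τ₂ : ℝ} (hL : 0 < L) (hν : 0 < ν)
    (hτ₂ : 0 < τ₂) (hτ₂' : τ₂ ≤ ν / (L * (ν + 1)))
    (hlip : ∀ x y, ‖G x - G y‖ ≤ L * ‖x - y‖) (z : E) :
    ‖G z - G (z - τ₂ • G z)‖ ≤ ν * ‖G (z - τ₂ • G z)‖ := by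
  have h1 := hlip z (z - τ₂ • G z)
  rw [sub_sub_cancel, norm_smul, Real.norm_of_nonneg hτ₂.le] at h1
  have h2 : τ₂ * (L * (ν + 1)) ≤ ν := (le_div_iff₀ (by positivity)).1 hτ₂'
  have h3 := norm_le_norm_add_norm_sub' (G z) (G (z - τ₂ • G z))
  have h4 := mul_le_mul_of_nonneg_right h2 (norm_nonneg (G z))
  nlinarith

/-- One step of gradient descent with momentum and an inexact gradient `v`. -/
theorem momentum_step_descent [CompleteSpace E] {f : E → ℝ} {G : E → E} {L ν τ β γ β' δ : ℝ}
    (hG : ∀ x, HasGradientAt f (G x) x) (hlip : ∀ x y, ‖G x - G y‖ ≤ L * ‖x - y‖)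
    (hL : 0 < L) (hν : 0 < ν) (hτ : 0 < τ) (hβ : 0 ≤ β) (hβ' : β ≤ β') (hδ : |β - γ| ≤ δ)
    {p q d v : E} (hq : q = p + β • d - τ • v) (hv : ‖G (p + γ • d) - v‖ ≤ ν * ‖v‖) :
    2 * τ * (f q - f p) ≤ (L * τ + ν - 1) * (τ * ‖v‖) ^ 2
      + (L * τ * δ + ν - 1) * ‖q - p‖ ^ 2
      + (L * τ * β' ^ 2 + L * τ * δ + β' ^ 2) * ‖d‖ ^ 2 := by
  have hs : q - p = β • d - τ • v := by rw [hq]; abel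
  have h1 := le_add_inner_add_sq_of_lipschitz_gradient hG hlip (p + β • d) q
  have h2 := add_inner_le_add_sq_of_lipschitz_gradient hG hlip (p + β • d) p
  rw [show q - (p + β • d) = -(τ • v) by rw [hq]; abel, inner_neg_right, norm_neg, norm_smul,
    Real.norm_of_nonneg hτ.le] at h1
  rw [show p - (p + β • d) = -(β • d) by abel, inner_neg_right, norm_neg, norm_smul,
    Real.norm_of_nonneg hβ] at h2
  have h3 : inner ℝ (G (p + β • d)) (q - p)
      = inner ℝ (G (p + β • d)) (β • d) - inner ℝ (G (p + β • d)) (τ • v) := by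
    rw [hs, inner_sub_right]
  have h4 : inner ℝ (G (p + β • d)) (q - p) =
      inner ℝ (G (p + β • d) - G (p + γ • d)) (q - p) + inner ℝ (G (p + γ • d) - v) (q - p)
        + inner ℝ v (q - p) := by
    simp only [inner_sub_left]; ring
  have h5 : inner ℝ (G (p + β • d) - G (p + γ • d)) (q - p) ≤ L * (δ * ‖d‖) * ‖q - p‖ := by
    refine (real_inner_le_norm _ _).trans (mul_le_mul_of_nonneg_right ?_ (norm_nonneg _))
    refine (hlip _ _).trans (mul_le_mul_of_nonneg_left ?_ hL.le)
    rw [add_sub_add_left_eq_sub, ← sub_smul, norm_smul]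
    exact mul_le_mul_of_nonneg_right hδ (norm_nonneg _)
  have h6 : inner ℝ (G (p + γ • d) - v) (q - p) ≤ ν * ‖v‖ * ‖q - p‖ :=
    (real_inner_le_norm _ _).trans (mul_le_mul_of_nonneg_right hv (norm_nonneg _))
  have h7 : β ^ 2 * ‖d‖ ^ 2 = ‖q - p‖ ^ 2 + 2 * (τ * inner ℝ v (q - p)) + τ ^ 2 * ‖v‖ ^ 2 := by
    have h8 : β • d = (q - p) + τ • v := by rw [hs]; abel
    have h9 := norm_add_sq_real (q - p) (τ • v)
    rw [← h8, norm_smul, norm_smul, real_inner_smul_right, real_inner_comm, mul_pow, mul_pow,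
      Real.norm_eq_abs, Real.norm_eq_abs, sq_abs, sq_abs] at h9
    exact h9
  have hδ0 : 0 ≤ δ := (abs_nonneg _).trans hδ
  have h10 : L * (δ * ‖d‖) * ‖q - p‖ ≤ L * δ / 2 * (‖d‖ ^ 2 + ‖q - p‖ ^ 2) := by
    nlinarith [mul_nonneg (mul_nonneg hL.le hδ0) (sq_nonneg (‖d‖ - ‖q - p‖))]
  have h11 : 2 * (ν * (τ * ‖v‖) * ‖q - p‖) ≤ ν * ((τ * ‖v‖) ^ 2 + ‖q - p‖ ^ 2) := by
    nlinarith [mul_nonneg hν.le (sq_nonneg (τ * ‖v‖ - ‖q - p‖))]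
  have h12 : β ^ 2 * ‖d‖ ^ 2 ≤ β' ^ 2 * ‖d‖ ^ 2 := by gcongr
  have h13 : f q - f p ≤ L * δ / 2 * (‖d‖ ^ 2 + ‖q - p‖ ^ 2) + ν * ‖v‖ * ‖q - p‖
      + inner ℝ v (q - p) + L / 2 * (τ * ‖v‖) ^ 2 + L / 2 * (β ^ 2 * ‖d‖ ^ 2) := by
    nlinarith
  have h14 := mul_le_mul_of_nonneg_left h13 (by positivity : 0 ≤ 2 * τ)
  have h15 := mul_le_mul_of_nonneg_left h12 (by positivity : 0 ≤ L * τ)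
  nlinarith

theorem norm_gradient_le_of_inexact {G : E → E} {L ν β γ β' δ : ℝ}
    (hlip : ∀ x y, ‖G x - G y‖ ≤ L * ‖x - y‖) (hL : 0 < L) (hγ : 0 ≤ γ) (hβ' : β ≤ β')
    (hδ : |β - γ| ≤ δ) {p d v : E} (hv : ‖G (p + γ • d) - v‖ ≤ ν * ‖v‖) :
    ‖G p‖ ≤ (ν + 1) * ‖v‖ + L * (β' + δ) * ‖d‖ := by
  have h1 := hlip p (p + γ • d)
  rw [sub_add_cancel_left, norm_neg, norm_smul, Real.norm_of_nonneg hγ] at h1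
  have h2 := norm_le_norm_add_norm_sub' (G p) (G (p + γ • d))
  have h3 := norm_le_norm_add_norm_sub' (G (p + γ • d)) v
  have h4 : γ ≤ β' + δ := by linarith [(abs_le.1 hδ).1]
  have h5 : L * (γ * ‖d‖) ≤ L * ((β' + δ) * ‖d‖) := by gcongr
  linarith

end Descent

/-- A sequence whose steps are controlled, near a cluster point, by the decrease of a nonnegative
potential converges to that cluster point. -/
theorem tendsto_of_mapClusterPt_of_norm_step_le {E : Type*} [NormedAddCommGroup E]
    {x : ℕ → E} {a : E} {P : ℕ → ℝ} {κ : ℝ} {U : Set E} (hκ : 0 < κ) (hU : U ∈ nhds a)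
    (hP0 : ∀ᶠ k in atTop, 0 ≤ P k) (hP : ∀ᶠ k in atTop, P (k + 1) ≤ P k)
    (hstep : ∀ᶠ k in atTop, x k ∈ U → κ * ‖x (k + 1) - x k‖ ≤ P k - P (k + 1))
    (ha : MapClusterPt a atTop x) : Tendsto x atTop (nhds a) := by
  obtain ⟨K, hK⟩ := eventually_atTop.1 (hP0.and (hP.and hstep))
  obtain ⟨l, hl⟩ : ∃ l, Tendsto P atTop (nhds l) := by
    have hanti : Antitone fun k => P (k + K) :=
      antitone_nat_of_succ_le fun k => by
        have := (hK (k + K) (by omega)).2.1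
        rwa [show k + 1 + K = k + K + 1 by omega]
    have hb : BddBelow (range fun k => P (k + K)) :=
      ⟨0, by rintro _ ⟨k, rfl⟩; exact (hK (k + K) (by omega)).1⟩
    exact ⟨_, (tendsto_add_atTop_iff_nat K).1 (tendsto_atTop_ciInf hanti hb)⟩
  have hle : ∀ N, K ≤ N → l ≤ P N := fun N hN => by
    refine le_of_tendsto hl (eventually_atTop.2 ⟨N, fun m hm => ?_⟩)
    induction m, hm using Nat.le_induction with
    | base => exact le_rfl
    | succ m hm ih => exact ((hK m (hN.trans hm)).2.1).trans ih
  obtain ⟨r₀, hr₀, hball⟩ := Metric.mem_nhds_iff.1 hU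
  rw [Metric.tendsto_atTop]
  intro r hr
  set ρ := min r r₀
  have hρ0 : 0 < ρ := lt_min hr hr₀
  have hev : ∀ᶠ k in atTop, K ≤ k ∧ P k < l + κ * (ρ / 2) :=
    (eventually_ge_atTop K).and (hl.eventually_lt_const (by simpa using (by positivity)))
  obtain ⟨k₀, hk₀x, hKk₀, hPk₀⟩ :=
    ((ha.frequently (Metric.ball_mem_nhds a (half_pos hρ0))).and_eventually hev).exists
  have hclose : ∀ N, K ≤ N → κ * ‖x N - x k₀‖ ≤ P k₀ - P N → dist (x N) a < ρ := by
    intro N hN h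
    have h1 : ‖x N - x k₀‖ < ρ / 2 := by
      have := hle N hN
      exact lt_of_mul_lt_mul_left (by linarith) hκ.le
    have h2 := dist_triangle (x N) (x k₀) a
    rw [dist_eq_norm (x N) (x k₀)] at h2
    have h3 : dist (x k₀) a < ρ / 2 := hk₀x
    linarith
  have hmain : ∀ N, k₀ ≤ N → κ * ‖x N - x k₀‖ ≤ P k₀ - P N := by
    intro N hN
    induction N, hN using Nat.le_induction with
    | base => simp
    | succ N hN ih =>
      have h1 := hclose N (hKk₀.trans hN) ih
      have h2 := (hK N (hKk₀.trans hN)).2.2 (hball (h1.trans_le (min_le_right _ _)))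
      have h3 := norm_sub_le_norm_sub_add_norm_sub (x (N + 1)) (x N) (x k₀)
      nlinarith
  exact ⟨k₀, fun N hN => (hclose N (hKk₀.trans hN) (hmain N hN)).trans_le (min_le_left _ _)⟩

theorem ConcaveOn.deriv_mul_sub_le {φ : ℝ → ℝ} {S : Set ℝ} {φ' s t : ℝ} (hφ : ConcaveOn ℝ S φ)
    (ht : t ∈ S) (hs : s ∈ S) (hts : t ≤ s) (hd : HasDerivAt φ φ' s) :
    φ' * (s - t) ≤ φ s - φ t := by
  rcases hts.eq_or_lt with rfl | hlt
  · simp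
  · have h := hφ.le_slope_of_hasDerivAt ht hs hlt hd
    rwa [slope_def_field, le_div_iff₀ (sub_pos.2 hlt)] at h

/-- If `f` satisfies the PLK condition at a cluster point of `y`, and the energy
`f (y k) - f a + c * D k ^ 2` decreases sufficiently to zero, then `y` converges. -/
theorem PLKCondition.tendsto_of_energy_descent {n : ℕ} {f : EuclideanSpace ℝ (Fin n) → ℝ}
    {a : EuclideanSpace ℝ (Fin n)} (hf : PLKCondition f a) {y : ℕ → EuclideanSpace ℝ (Fin n)}
    {A D e : ℕ → ℝ} {c C ε : ℝ} (hc : 0 < c) (hC : 0 < C) (hε : 0 < ε) (hA : ∀ k, 0 ≤ A k)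
    (hD : ∀ k, 0 ≤ D k) (he : ∀ k, e k = f (y k) - f a + c * D k ^ 2) (he0 : ∀ k, 0 ≤ e k)
    (helim : Tendsto e atTop (nhds 0))
    (hdesc : ∀ k, ε * (A k ^ 2 + D k ^ 2 + ‖y (k + 1) - y k‖ ^ 2) ≤ e k - e (k + 1))
    (hgrad : ∀ k, ‖gradient f (y k)‖ ≤ C * (A k + D k)) (ha : MapClusterPt a atTop y) :
    Tendsto y atTop (nhds a) := by
  obtain ⟨η, U, φ, hη, hU, -, hφ0, hφc, hφd, -, hφpos, hPL⟩ := hf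
  have hanti : ∀ k, e (k + 1) ≤ e k := fun k => by
    have : 0 ≤ ε * (A k ^ 2 + D k ^ 2 + ‖y (k + 1) - y k‖ ^ 2) := by positivity
    linarith [hdesc k]
  have hsmall : ∀ᶠ k in atTop, e k < η := helim.eventually_lt_const hη
  have hsq : ∀ k, √(e (k + 1)) ≤ √(e k) := fun k => Real.sqrt_le_sqrt (hanti k)
  have hprod : ∀ k, ε * ((A k + D k) * ‖y (k + 1) - y k‖) ≤ e k - e (k + 1) := fun k =>
    (mul_le_mul_of_nonneg_left (by
      nlinarith [sq_nonneg (A k - D k), sq_nonneg (A k + D k - ‖y (k + 1) - y k‖),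
        sq_nonneg (A k), sq_nonneg (D k)]) hε.le).trans (hdesc k)
  have hmem : ∀ {k}, e k < η → e k / 2 ∈ Set.Ico 0 η := fun {k} h =>
    ⟨by linarith [he0 k], by linarith [he0 k]⟩
  have hφle : ∀ k, e k < η → φ (e (k + 1) / 2) ≤ φ (e k / 2) := fun k hk => by
    rcases (he0 k).eq_or_lt with h0 | h0
    · rw [← h0, le_antisymm (by linarith [hanti k]) (he0 (k + 1))]
    · have hmem' : e k / 2 ∈ Set.Ioo 0 η := ⟨by linarith, by linarith⟩
      have h1 := hφc.deriv_mul_sub_le (hmem ((hanti k).trans_lt hk)) (hmem hk)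
        (by linarith [hanti k]) (hφd _ hmem')
      have h2 := mul_nonneg (hφpos _ hmem').le
        (by linarith [hanti k] : 0 ≤ e k / 2 - e (k + 1) / 2)
      linarith
  set κ := min (ε / (2 * C)) (ε / (2 * √(2 * c)))
  have hκ0 : 0 < κ := lt_min (by positivity) (by positivity)
  refine tendsto_of_mapClusterPt_of_norm_step_le (P := fun k => φ (e k / 2) + √(e k)) hκ0 hU
    ?_ ?_ ?_ ha
  · filter_upwards [hsmall] with k hk
    exact add_nonneg (hφ0 _ (hmem hk)) (Real.sqrt_nonneg _)
  · filter_upwards [hsmall] with k hk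
    exact add_le_add (hφle k hk) (hsq k)
  · filter_upwards [hsmall] with k hk hyU
    have hS := norm_nonneg (y (k + 1) - y k)
    rcases (he0 k).eq_or_lt with h0 | h0
    · have h1 : e (k + 1) = 0 := le_antisymm (by linarith [hanti k]) (he0 (k + 1))
      have h2 : ‖y (k + 1) - y k‖ = 0 := by
        have h3 := hdesc k
        rw [h1, ← h0, sub_zero] at h3
        have h4 : A k ^ 2 + D k ^ 2 + ‖y (k + 1) - y k‖ ^ 2 ≤ 0 :=
          nonpos_of_mul_nonpos_right h3 hε
        exact pow_eq_zero_iff two_ne_zero |>.1 (by nlinarith [sq_nonneg (A k), sq_nonneg (D k)])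
      simp [h1, h2, ← h0]
    have hφk := hφle k hk
    have hsqk := hsq k
    by_cases hcase : e k / 2 ≤ f (y k) - f a
    · have hmem' : e k / 2 ∈ Set.Ioo 0 η := ⟨by linarith, by linarith⟩
      have hle : f (y k) - f a ≤ e k := by
        have := mul_nonneg hc.le (sq_nonneg (D k))
        linarith [he k]
      have hmem'' : f (y k) - f a ∈ Set.Ioo 0 η := ⟨by linarith, by linarith⟩
      have hd1 : deriv φ (f (y k) - f a) ≤ deriv φ (e k / 2) :=
        (hφc.subset Ioo_subset_Ico_self (convex_Ioo 0 η)).antitoneOn_deriv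
          (fun t ht => (hφd t ht).differentiableAt) hmem' hmem'' hcase
      have hd2 := hPL (y k) hyU (by linarith) (by linarith)
      have hd3 := hφc.deriv_mul_sub_le (hmem ((hanti k).trans_lt hk)) (hmem hk)
        (by linarith [hanti k]) (hφd _ hmem')
      have hpos := hφpos _ hmem'
      have hd4 : 1 ≤ deriv φ (e k / 2) * (C * (A k + D k)) :=
        hd2.trans (mul_le_mul hd1 (hgrad k) (norm_nonneg _) hpos.le)
      have hd5 : ε / (2 * C) * ‖y (k + 1) - y k‖ ≤ φ (e k / 2) - φ (e (k + 1) / 2) :=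
        calc ε / (2 * C) * ‖y (k + 1) - y k‖
            ≤ ε / (2 * C) * ‖y (k + 1) - y k‖ * (deriv φ (e k / 2) * (C * (A k + D k))) :=
              le_mul_of_one_le_right (by positivity) hd4
          _ = deriv φ (e k / 2) * (ε * ((A k + D k) * ‖y (k + 1) - y k‖) / 2) := by
              field_simp
          _ ≤ deriv φ (e k / 2) * (e k / 2 - e (k + 1) / 2) :=
              mul_le_mul_of_nonneg_left (by linarith [hprod k]) hpos.le
          _ ≤ _ := hd3
      have hd6 := mul_le_mul_of_nonneg_right (min_le_left _ _ : κ ≤ ε / (2 * C)) hS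
      linarith
    · have hDlow : e k ≤ 2 * c * D k ^ 2 := by linarith [he k]
      have hs1 : √(e k) ≤ √(2 * c) * D k := by
        rw [← Real.sqrt_sq (hD k), ← Real.sqrt_mul (by positivity)]
        exact Real.sqrt_le_sqrt hDlow
      have hs2 : 0 < √(e k) := Real.sqrt_pos.2 h0
      have hDpos : 0 < D k := pos_of_mul_pos_right (hs2.trans_le hs1) (Real.sqrt_nonneg _)
      have hs3 : ε * (D k * ‖y (k + 1) - y k‖)
          ≤ (√(e k) - √(e (k + 1))) * (2 * (√(2 * c) * D k)) :=
        calc ε * (D k * ‖y (k + 1) - y k‖)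
            ≤ ε * ((A k + D k) * ‖y (k + 1) - y k‖) := by
              gcongr; linarith [hA k]
          _ ≤ e k - e (k + 1) := hprod k
          _ = (√(e k) - √(e (k + 1))) * (√(e k) + √(e (k + 1))) := by
              nlinarith [Real.sq_sqrt (he0 k), Real.sq_sqrt (he0 (k + 1))]
          _ ≤ _ := mul_le_mul_of_nonneg_left (by linarith) (by linarith)
      have hs4 : ε / (2 * √(2 * c)) * ‖y (k + 1) - y k‖ ≤ √(e k) - √(e (k + 1)) := by
        rw [div_mul_eq_mul_div, div_le_iff₀ (by positivity)]
        exact le_of_mul_le_mul_right (by linarith) hDpos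
      have hs5 := mul_le_mul_of_nonneg_right (min_le_right _ _ : κ ≤ ε / (2 * √(2 * c))) hS
      linarith

/-- Global convergence of the extragradient method with momentum (EGm). -/
theorem EGm_global_convergence {n : ℕ}
    (f : EuclideanSpace ℝ (Fin n) → ℝ)
    (hdiff : Differentiable ℝ f)
    (L : ℝ) (hL : 0 < L)
    (hlip : ∀ x y : EuclideanSpace ℝ (Fin n),
      ‖gradient f x - gradient f y‖ ≤ L * ‖x - y‖)
    (ν τ₁ τ₂ βbar δbar : ℝ) (hν : ν ∈ Set.Ioo (0:ℝ) 1)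
    (hτ₁ : 0 < τ₁) (hτ₂ : 0 < τ₂) (hτ₂' : τ₂ ≤ ν / (L * (ν + 1)))
    (hparam : max (L*τ₁) (2*L*τ₁*δbar + (L*τ₁+1)*βbar^2) < 1 - ν)
    (β γ : ℕ → ℝ) (hβnn : ∀ k, 0 ≤ β k) (hγnn : ∀ k, 0 ≤ γ k)
    (hβbar : ∀ k, β k ≤ βbar) (hβbar1 : βbar < 1)
    (hδbar : ∀ k, |β k - γ k| ≤ δbar)
    (x xin xex : ℕ → EuclideanSpace ℝ (Fin n))
    (hx01 : x 0 = x 1)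
    (hxin : ∀ k, 1 ≤ k → xin k = x k + β k • (x k - x (k-1)))
    (hxex : ∀ k, 1 ≤ k → xex k = x k + γ k • (x k - x (k-1)))
    (hupd : ∀ k, 1 ≤ k →
      x (k+1) = xin k - τ₁ • gradient f (xex k - τ₂ • gradient f (xex k)))
    (hbdd : ∃ m : ℝ, ∀ k, m ≤ f (x k)) :
    Tendsto (fun k => gradient f (x k)) atTop (nhds 0) ∧
    ∀ xb : EuclideanSpace ℝ (Fin n),
      (∀ k, 1 ≤ k → gradient f (xex k) ≠ 0) →
      PLKCondition f xb →
      MapClusterPt xb atTop x →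
      Tendsto x atTop (nhds xb) ∧ gradient f xb = 0 := by
  obtain ⟨m, hm⟩ := hbdd
  obtain ⟨hν0, hν1⟩ := hν
  have hG : ∀ z, HasGradientAt f (gradient f z) z := fun z => (hdiff z).hasGradientAt
  have hβ0 : 0 ≤ βbar := (hβnn 0).trans (hβbar 0)
  have hδ0 : 0 ≤ δbar := (abs_nonneg _).trans (hδbar 0)
  have hp1 := (le_max_left _ _).trans_lt hparam
  have hp2 := (le_max_right _ _).trans_lt hparam
  set v : ℕ → EuclideanSpace ℝ (Fin n) := fun k =>
    gradient f (xex (k + 1) - τ₂ • gradient f (xex (k + 1)))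
  set y : ℕ → EuclideanSpace ℝ (Fin n) := fun k => x (k + 1)
  set D : ℕ → ℝ := fun k => ‖x (k + 1) - x k‖
  set A : ℕ → ℝ := fun k => τ₁ * ‖v k‖ with hA
  have hD0 : ∀ k, 0 ≤ D k := fun k => norm_nonneg _
  have hA0 : ∀ k, 0 ≤ A k := fun k => by positivity
  have hex : ∀ k, xex (k + 1) = x (k + 1) + γ (k + 1) • (x (k + 1) - x k) := fun k => by
    simpa using hxex (k + 1) (by omega)
  have hv : ∀ k, ‖gradient f (x (k + 1) + γ (k + 1) • (x (k + 1) - x k)) - v k‖ ≤ ν * ‖v k‖ :=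
    fun k => by
      rw [← hex]
      exact norm_gradient_sub_lookahead_le hL hν0 hτ₂ hτ₂' hlip _
  have hq : ∀ k, x (k + 1 + 1) = x (k + 1) + β (k + 1) • (x (k + 1) - x k) - τ₁ • v k :=
    fun k => by
      rw [hupd (k + 1) (by omega), hxin (k + 1) (by omega), Nat.add_sub_cancel]
  have hstep := fun k => momentum_step_descent hG hlip hL hν0 hτ₁ (hβnn (k + 1)) (hβbar (k + 1))
    (hδbar (k + 1)) (hq k) (hv k)
  set C : ℝ := (ν + 1) / τ₁ + L * (βbar + δbar) with hC
  have hC0 : 0 < C := by positivity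
  have hgrad : ∀ k, ‖gradient f (y k)‖ ≤ C * (A k + D k) := fun k => by
    have h1 := norm_gradient_le_of_inexact hlip hL (hγnn (k + 1)) (hβbar (k + 1))
      (hδbar (k + 1)) (hv k)
    have h2 : (ν + 1) * ‖v k‖ = (ν + 1) / τ₁ * A k := by simp only [hA]; field_simp
    have h3 : 0 ≤ (ν + 1) / τ₁ * D k := mul_nonneg (by positivity) (hD0 k)
    have h4 : 0 ≤ L * (βbar + δbar) * A k := mul_nonneg (by positivity) (hA0 k)
    rw [h2] at h1
    calc ‖gradient f (y k)‖ ≤ (ν + 1) / τ₁ * A k + L * (βbar + δbar) * D k := h1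
      _ ≤ C * (A k + D k) := by rw [hC]; linarith
  set θ : ℝ := 1 - ν - (2 * L * τ₁ * δbar + (L * τ₁ + 1) * βbar ^ 2) with hθ
  have hθ0 : 0 < θ := by linarith
  set c : ℝ := (L * τ₁ * βbar ^ 2 + L * τ₁ * δbar + βbar ^ 2 + θ / 2) / (2 * τ₁) with hc
  have hc0 : 0 < c := by positivity
  set ε : ℝ := min (1 - ν - L * τ₁) (θ / 2) / (2 * τ₁) with hε
  have hε0 : 0 < ε := div_pos (lt_min (by linarith) (by linarith)) (by positivity)
  set H : ℕ → ℝ := fun k => f (y k) + c * D k ^ 2 with hH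
  have hdesc : ∀ k, ε * (A k ^ 2 + D k ^ 2 + ‖y (k + 1) - y k‖ ^ 2) ≤ H k - H (k + 1) := by
    intro k
    have h1 := hstep k
    have h2 : 2 * τ₁ * c = L * τ₁ * βbar ^ 2 + L * τ₁ * δbar + βbar ^ 2 + θ / 2 := by
      rw [hc]; field_simp
    have h3 : 2 * τ₁ * ε = min (1 - ν - L * τ₁) (θ / 2) := by rw [hε]; field_simp
    have h4 := min_le_left (1 - ν - L * τ₁) (θ / 2)
    have h5 := min_le_right (1 - ν - L * τ₁) (θ / 2)
    rw [← h3] at h4 h5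
    have h6 := mul_le_mul_of_nonneg_right h4 (sq_nonneg (A k))
    have h7 := mul_le_mul_of_nonneg_right h5 (sq_nonneg (D k))
    have h8 := mul_le_mul_of_nonneg_right h5 (sq_nonneg (D (k + 1)))
    refine le_of_mul_le_mul_left ?_ (by positivity : 0 < 2 * τ₁)
    change 2 * τ₁ * (f (y (k + 1)) - f (y k)) ≤ (L * τ₁ + ν - 1) * A k ^ 2
      + (L * τ₁ * δbar + ν - 1) * D (k + 1) ^ 2
      + (L * τ₁ * βbar ^ 2 + L * τ₁ * δbar + βbar ^ 2) * D k ^ 2 at h1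
    change 2 * τ₁ * (ε * (A k ^ 2 + D k ^ 2 + D (k + 1) ^ 2))
      ≤ 2 * τ₁ * (f (y k) + c * D k ^ 2 - (f (y (k + 1)) + c * D (k + 1) ^ 2))
    linear_combination h1 + h6 + h7 + h8 + (D (k + 1) ^ 2 - D k ^ 2) * h2 + D (k + 1) ^ 2 * hθ
  have hanti : Antitone H := antitone_nat_of_succ_le fun k => by
    have : 0 ≤ ε * (A k ^ 2 + D k ^ 2 + ‖y (k + 1) - y k‖ ^ 2) := by positivity
    linarith [hdesc k]
  have hbdd : BddBelow (range H) := ⟨m, by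
    rintro _ ⟨k, rfl⟩
    exact (hm (k + 1)).trans (le_add_of_nonneg_right (by positivity))⟩
  obtain ⟨l, hl⟩ : ∃ l, Tendsto H atTop (nhds l) := ⟨_, tendsto_atTop_ciInf hanti hbdd⟩
  have hdiff0 : Tendsto (fun k => (H k - H (k + 1)) / ε) atTop (nhds 0) := by
    simpa using (hl.sub ((tendsto_add_atTop_iff_nat 1).2 hl)).div_const ε
  have hsq : ∀ k, A k ^ 2 + D k ^ 2 ≤ (H k - H (k + 1)) / ε := fun k => by
    rw [le_div_iff₀ hε0]
    nlinarith [hdesc k, mul_nonneg hε0.le (sq_nonneg ‖y (k + 1) - y k‖)]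
  have hDsq : Tendsto (fun k => D k ^ 2) atTop (nhds 0) :=
    squeeze_zero (fun k => sq_nonneg _)
      (fun k => by linarith [hsq k, sq_nonneg (A k)]) hdiff0
  have hAsq : Tendsto (fun k => A k ^ 2) atTop (nhds 0) :=
    squeeze_zero (fun k => sq_nonneg _)
      (fun k => by linarith [hsq k, sq_nonneg (D k)]) hdiff0
  have hDlim : Tendsto D atTop (nhds 0) := by
    simpa [Real.sqrt_sq (hD0 _)] using hDsq.sqrt
  have hAlim : Tendsto A atTop (nhds 0) := by
    simpa [Real.sqrt_sq (hA0 _)] using hAsq.sqrt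
  have hgrad0 : Tendsto (fun k => gradient f (x k)) atTop (nhds 0) := by
    refine (tendsto_add_atTop_iff_nat 1).1 (squeeze_zero_norm hgrad ?_)
    simpa using (hAlim.add hDlim).const_mul C
  refine ⟨hgrad0, fun xb _ hPLK hcl => ?_⟩
  have hcl' : MapClusterPt xb atTop y := by
    change MapClusterPt xb atTop (x ∘ fun k => k + 1)
    rwa [mapClusterPt_comp, map_add_atTop_eq_nat]
  have hfl : Tendsto (f ∘ y) atTop (nhds l) := by
    have h := hl.sub (hDsq.const_mul c)
    simp only [hH, add_sub_cancel_right, mul_zero, sub_zero] at h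
    exact h
  have hfxb : f xb = l := eq_of_nhds_neBot
    ((hcl'.continuousAt_comp (hdiff xb).continuousAt).clusterPt.mono hfl)
  have hconv : Tendsto y atTop (nhds xb) :=
    hPLK.tendsto_of_energy_descent (e := fun k => H k - l) hc0 hC0 hε0 hA0 hD0
      (fun k => by simp only [hH, hfxb]; ring)
      (fun k => sub_nonneg.2 (hanti.le_of_tendsto hl k))
      (by simpa using hl.sub_const l) (fun k => by linarith [hdesc k]) hgrad hcl'
  have hx : Tendsto x atTop (nhds xb) := (tendsto_add_atTop_iff_nat 1).1 hconv
  have hcont : Continuous (gradient f) :=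
    (LipschitzWith.of_dist_le_mul (K := L.toNNReal) fun z w => by
      simpa [dist_eq_norm, Real.coe_toNNReal _ hL.le] using hlip z w).continuous
  exact ⟨hx, tendsto_nhds_unique ((hcont.tendsto xb).comp hx) hgrad0⟩
end

section
/- Let f : ℝⁿ → ℝ be C¹ with L-Lipschitz gradient on all of ℝⁿ, let ν ∈ (0,1), τ₂ ≤ ν/(L(ν+1)), and τ₁ > 0 with max{Lτ₁, 2Lτ₁δ̄ + (Lτ₁+1)β̄²} < 1 − ν, and let (x^k) be the sharpness-aware-minimization-with-momentum (SAMm) iterates: x⁰ = x¹ ∈ ℝⁿ, x^k_in := x^k + β_k(x^k − x^{k−1}), x^k_ex := x^k + γ_k(x^k − x^{k−1}), x^{k+1} := x^k_in − τ₁∇f(x^k_ex + τ₂∇f(x^k_ex)), where (β_k), (γ_k) are nonnegative with β̄ := sup β_k < 1 and δ̄ := sup|β_k − γ_k| < ∞. If inf_k f(x^k) > −∞, then ∇f(x^k) → 0; if in addition ∇f(x^k_ex) ≠ 0 for all k and f satisfies the PLK condition at an accumulation point x̄ of (x^k), then x^k → x̄ and ∇f(x̄) = 0. -/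
open Set Filter

open Topology in
/-- A sequence whose steps are controlled, near a cluster point, by the decrease of a convergent
sequence converges to that cluster point. -/
lemma tendsto_of_mapClusterPt_of_step_le {E : Type*} [NormedAddCommGroup E]
    {y d : ℕ → E} {yb : E} {u : ℕ → ℝ} {l M r : ℝ} {K₀ : ℕ}
    (hr : 0 < r) (hM : 0 ≤ M) (hy : ∀ k, y (k + 1) = y k + d (k + 1))
    (hd : Tendsto d atTop (𝓝 0)) (hu : Tendsto u atTop (𝓝 l)) (hlu : ∀ k, K₀ ≤ k → l ≤ u k)
    (hcl : MapClusterPt yb atTop y)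
    (hstep : ∀ k, K₀ ≤ k → ‖y k - yb‖ < r →
      ‖d (k + 1)‖ ≤ M * (u k - u (k + 1)) + ‖d k‖ / 2) :
    Tendsto y atTop (𝓝 yb) := by
  rw [Metric.tendsto_atTop]
  intro ε hε
  set ρ := min ε r with hρ
  have hρ0 : 0 < ρ := lt_min hε hr
  have h1 : Tendsto (fun k => ‖d k‖ + 2 * M * (u k - l)) atTop (𝓝 0) := by
    have := hd.norm.add ((hu.sub_const l).const_mul (2 * M))
    simpa using this
  have h2 : ∀ᶠ k in atTop, ‖d k‖ + 2 * M * (u k - l) < ρ / 2 :=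
    h1.eventually (gt_mem_nhds (by positivity))
  have h3 : ∃ᶠ k in atTop, dist (y k) yb < ρ / 2 :=
    hcl.frequently (Metric.ball_mem_nhds yb (by positivity))
  obtain ⟨K, hK3, hK2, hK⟩ := (h3.and_eventually (h2.and (eventually_ge_atTop K₀))).exists
  rw [dist_eq_norm] at hK3
  have key : ∀ N, K ≤ N → ‖y N - yb‖ + ‖d N‖ + 2 * M * (u N - l) < ρ := by
    intro N hN
    induction N, hN using Nat.le_induction with
    | base => linarith
    | succ N hN ih =>
      have hnn : 0 ≤ 2 * M * (u N - l) :=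
        mul_nonneg (by positivity) (sub_nonneg.2 (hlu N (hK.trans hN)))
      have hs := hstep N (hK.trans hN)
        (by have := norm_nonneg (d N); have := min_le_right ε r; linarith)
      have ht : ‖y (N + 1) - yb‖ ≤ ‖y N - yb‖ + ‖d (N + 1)‖ := by
        rw [hy, add_sub_right_comm]
        exact norm_add_le _ _
      linarith
  refine ⟨K, fun N hN => ?_⟩
  have hnn : 0 ≤ 2 * M * (u N - l) :=
    mul_nonneg (by positivity) (sub_nonneg.2 (hlu N (hK.trans hN)))
  have := key N hN
  have := norm_nonneg (d N)
  have := min_le_left ε r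
  rw [dist_eq_norm]
  linarith

/-- The relative error between the gradient at a point and at its perturbation. -/
lemma norm_sub_le_mul_norm_of_perturbed {E : Type*} [NormedAddCommGroup E] {e g : E} {L τ ν : ℝ}
    (hL : 0 < L) (hν : 0 < ν) (hτ : τ ≤ ν / (L * (ν + 1)))
    (h : ‖g - e‖ ≤ L * (τ * ‖e‖)) : ‖g - e‖ ≤ ν * ‖g‖ := by
  have h1 : L * τ * (ν + 1) ≤ ν := by
    rw [le_div_iff₀ (by positivity)] at hτ
    linarith
  have h2 : ‖e‖ ≤ ‖g‖ + ‖g - e‖ := by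
    have := norm_sub_le g (g - e)
    simpa using this
  nlinarith [mul_le_mul_of_nonneg_right h1 (norm_nonneg e),
    mul_le_mul_of_nonneg_left h (by positivity : 0 ≤ ν + 1)]

section Hilbert

variable {E : Type*} [NormedAddCommGroup E] [InnerProductSpace ℝ E]

/-- The quadratic upper bound for a function with Lipschitz gradient. -/
lemma le_add_inner_add_of_lipschitz_gradient [CompleteSpace E] {f : E → ℝ} {G : E → E} {L : ℝ}
    (hf : ∀ z, HasGradientAt f (G z) z) (hlip : ∀ y z, ‖G y - G z‖ ≤ L * ‖y - z‖) (y z : E) :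
    f z ≤ f y + inner ℝ (G y) (z - y) + L / 2 * ‖z - y‖ ^ 2 := by
  set v := z - y with hv
  let h : ℝ → ℝ := fun t => f (y + t • v) - (t * inner ℝ (G y) v + L / 2 * t ^ 2 * ‖v‖ ^ 2)
  have hh : ∀ t, HasDerivAt h (inner ℝ (G (y + t • v)) v -
      (inner ℝ (G y) v + L * t * ‖v‖ ^ 2)) t := by
    intro t
    have h1 : HasDerivAt (fun t : ℝ => y + t • v) v t := by
      simpa using ((hasDerivAt_id t).smul_const v).const_add y
    have h2 : HasDerivAt (fun t : ℝ => f (y + t • v)) (inner ℝ (G (y + t • v)) v) t := by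
      have := (hf (y + t • v)).hasFDerivAt.comp_hasDerivAt t h1
      simpa [Function.comp_def] using this
    have h3 : HasDerivAt (fun t : ℝ => t * inner ℝ (G y) v + L / 2 * t ^ 2 * ‖v‖ ^ 2)
        (inner ℝ (G y) v + L * t * ‖v‖ ^ 2) t := by
      have h4 := ((hasDerivAt_id t).mul_const (inner ℝ (G y) v)).add
        ((((hasDerivAt_id t).pow 2).const_mul (L / 2)).mul_const (‖v‖ ^ 2))
      refine h4.congr_deriv ?_
      simp only [id, one_mul, Nat.cast_ofNat]
      ring
    exact h2.sub h3
  have hanti : AntitoneOn h (Icc 0 1) := by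
    refine antitoneOn_of_deriv_nonpos (convex_Icc 0 1)
      (fun t _ => (hh t).continuousAt.continuousWithinAt)
      (fun t _ => (hh t).differentiableAt.differentiableWithinAt) fun t ht => ?_
    rw [interior_Icc] at ht
    rw [(hh t).deriv]
    have h1 : inner ℝ (G (y + t • v) - G y) v ≤ L * ‖t • v‖ * ‖v‖ := by
      refine (real_inner_le_norm _ _).trans ?_
      refine mul_le_mul_of_nonneg_right ?_ (norm_nonneg v)
      simpa using hlip (y + t • v) y
    rw [inner_sub_left, norm_smul, Real.norm_of_nonneg ht.1.le] at h1
    nlinarith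
  have := hanti (left_mem_Icc.2 zero_le_one) (right_mem_Icc.2 zero_le_one) zero_le_one
  simp only [h, one_smul, zero_smul, add_zero, one_pow, mul_one, one_mul, zero_mul] at this
  have hz : y + v = z := by simp [hv]
  rw [hz] at this
  norm_num at this
  linarith

/-- The quadratic lower bound for a function with Lipschitz gradient. -/
lemma add_inner_sub_le_of_lipschitz_gradient [CompleteSpace E] {f : E → ℝ} {G : E → E} {L : ℝ}
    (hf : ∀ z, HasGradientAt f (G z) z) (hlip : ∀ y z, ‖G y - G z‖ ≤ L * ‖y - z‖) (y z : E) :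
    f y + inner ℝ (G y) (z - y) - L / 2 * ‖z - y‖ ^ 2 ≤ f z := by
  have hf' : ∀ z, HasGradientAt (fun w => - f w) (- G z) z := by
    intro z
    rw [hasGradientAt_iff_hasFDerivAt, map_neg]
    exact (hf z).hasFDerivAt.neg
  have := le_add_inner_add_of_lipschitz_gradient hf' (L := L)
    (fun y z => by rw [← neg_sub', norm_neg]; exact hlip y z) y z
  rw [inner_neg_left] at this
  linarith

/-- Bound for the linear term of a heavy-ball step `d' = b • d - τ • g` along which the true
gradient `m` is approximated by `g`. -/
lemma two_mul_inner_le_of_momentum_step {d d' g m : E} {b τ ν c : ℝ} (hτ : 0 ≤ τ) (hν : 0 ≤ ν)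
    (hc : 0 ≤ c) (hd' : d' = b • d - τ • g) (hm : ‖m - g‖ ≤ c * ‖d‖ + ν * ‖g‖) :
    2 * τ * inner ℝ m d' ≤ (b ^ 2 + τ * c) * ‖d‖ ^ 2 - (1 - ν - τ * c) * ‖d'‖ ^ 2
      - τ ^ 2 * (1 - ν) * ‖g‖ ^ 2 := by
  have h1 : b ^ 2 * ‖d‖ ^ 2 = ‖d'‖ ^ 2 + 2 * (τ * inner ℝ g d') + τ ^ 2 * ‖g‖ ^ 2 := by
    have h2 : b • d = d' + τ • g := by rw [hd']; abel
    have h3 : ‖b • d‖ ^ 2 = b ^ 2 * ‖d‖ ^ 2 := by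
      rw [norm_smul, mul_pow, Real.norm_eq_abs, sq_abs]
    have h4 : ‖τ • g‖ ^ 2 = τ ^ 2 * ‖g‖ ^ 2 := by
      rw [norm_smul, mul_pow, Real.norm_eq_abs, sq_abs]
    rw [← h3, h2, norm_add_sq_real, h4, inner_smul_right, real_inner_comm]
  have h5 : inner ℝ m d' - inner ℝ g d' ≤ (c * ‖d‖ + ν * ‖g‖) * ‖d'‖ := by
    rw [← inner_sub_left]
    exact (real_inner_le_norm _ _).trans (mul_le_mul_of_nonneg_right hm (norm_nonneg _))
  have h6 := mul_le_mul_of_nonneg_left h5 hτ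
  have h7 := mul_nonneg (mul_nonneg hτ hc) (sq_nonneg (‖d‖ - ‖d'‖))
  have h8 := mul_nonneg hν (sq_nonneg (τ * ‖g‖ - ‖d'‖))
  linarith

/-- Descent of the function value along a momentum step, up to quadratic terms. -/
lemma momentum_step_descent_s17 [CompleteSpace E] {f : E → ℝ} {G : E → E} {L : ℝ}
    (hf : ∀ z, HasGradientAt f (G z) z) (hlip : ∀ y z, ‖G y - G z‖ ≤ L * ‖y - z‖)
    {x d g : E} {b τ ν c : ℝ} (hτ : 0 ≤ τ) (hν : 0 ≤ ν) (hc : 0 ≤ c)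
    (hm : ‖G (x + b • d) - g‖ ≤ c * ‖d‖ + ν * ‖g‖) :
    2 * τ * f (x + b • d - τ • g) ≤ 2 * τ * f x
      + ((1 + L * τ) * b ^ 2 + τ * c) * ‖d‖ ^ 2 - (1 - ν - τ * c) * ‖b • d - τ • g‖ ^ 2
      - τ ^ 2 * (1 - ν - L * τ) * ‖g‖ ^ 2 := by
  set w := x + b • d with hw
  have h1 := le_add_inner_add_of_lipschitz_gradient hf hlip w (w - τ • g)
  have h2 := add_inner_sub_le_of_lipschitz_gradient hf hlip w x
  have h3 := two_mul_inner_le_of_momentum_step (d' := b • d - τ • g) hτ hν hc rfl hm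
  have e1 : w - τ • g - w = - (τ • g) := by abel
  have e2 : x - w = - (b • d) := by rw [hw]; abel
  have e3 : ‖b • d‖ ^ 2 = b ^ 2 * ‖d‖ ^ 2 := by
    rw [norm_smul, mul_pow, Real.norm_eq_abs, sq_abs]
  have e4 : ‖τ • g‖ ^ 2 = τ ^ 2 * ‖g‖ ^ 2 := by
    rw [norm_smul, mul_pow, Real.norm_eq_abs, sq_abs]
  rw [e1, norm_neg, e4, inner_neg_right] at h1
  rw [e2, norm_neg, e3, inner_neg_right] at h2
  rw [inner_sub_right] at h3
  have h4 := mul_le_mul_of_nonneg_left (h1.trans (add_le_add_left (add_le_add_left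
    (by linarith : f w ≤ f x + inner ℝ (G w) (b • d) + L / 2 * (b ^ 2 * ‖d‖ ^ 2)) _) _))
    (by positivity : 0 ≤ 2 * τ)
  linarith

end Hilbert

/-- A concave function lies below its tangents. -/
lemma ConcaveOn.le_add_deriv_mul_sub {S : Set ℝ} {φ : ℝ → ℝ} (hφ : ConcaveOn ℝ S φ)
    {s t φ' : ℝ} (hs : s ∈ S) (ht : t ∈ S) (hd : HasDerivAt φ φ' s) :
    φ t ≤ φ s + φ' * (t - s) := by
  rcases lt_trichotomy s t with h | h | h
  · have := hφ.slope_le_of_hasDerivAt hs ht h hd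
    rw [slope_def_field, div_le_iff₀ (sub_pos.2 h)] at this
    linarith
  · simp [h]
  · have := hφ.le_slope_of_hasDerivAt ht hs h hd
    rw [slope_def_field, le_div_iff₀ (sub_pos.2 h)] at this
    linarith

/-- A step whose square is bounded by a decrease `D` times the sum of itself and the previous
step is bounded by a multiple of the decrease plus half the previous step. -/
lemma le_three_mul_add_half {a b D : ℝ} (ha : 0 ≤ a) (hb : 0 ≤ b) (hD : 0 ≤ D)
    (h : a ^ 2 ≤ D * (a + b)) : a ≤ 3 * D + b / 2 := by
  by_contra! h1
  nlinarith

/-- A sequence whose square is controlled by the decrease of a convergent sequence tends to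
zero. -/
lemma tendsto_zero_of_mul_sq_le_sub {E : Type*} [NormedAddCommGroup E] {z : ℕ → E} {V : ℕ → ℝ}
    {c l : ℝ} (hc : 0 < c) (hV : Tendsto V atTop (nhds l))
    (h : ∀ k, c * ‖z k‖ ^ 2 ≤ V k - V (k + 1)) : Tendsto z atTop (nhds 0) := by
  have h1 : Tendsto (fun k => √((V k - V (k + 1)) / c)) atTop (nhds 0) := by
    have := ((hV.sub ((tendsto_add_atTop_iff_nat 1).2 hV)).div_const c).sqrt
    simpa using this
  refine squeeze_zero_norm (fun k => Real.le_sqrt_of_sq_le ?_) h1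
  rw [le_div_iff₀ hc]
  linarith [h k]

/-- The step estimate obtained from the PLK inequality for `f` when the merit function is `f`
plus a multiple of the squared step: here `F` is the function gap, `G` the gradient norm, `2 * p`
the merit gap, and `s`, `s'` are consecutive step lengths. -/
lemma mul_sq_le_of_desingularizing {φ : ℝ → ℝ} {η p p' F G a c C s s' : ℝ}
    (hconc : ConcaveOn ℝ (Ico 0 η) φ)
    (hder : ∀ t ∈ Ioo (0 : ℝ) η, HasDerivAt φ (deriv φ t) t)
    (hpos : ∀ t ∈ Ioo (0 : ℝ) η, 0 < deriv φ t)
    (hp' : 0 < p') (hpp : p' ≤ p) (hpη : 2 * p < η) (ha : 0 ≤ a) (hC : 0 ≤ C)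
    (hs : 0 ≤ s) (hs' : 0 ≤ s') (hF : F = 2 * p - a * s ^ 2)
    (hPLK : 0 < F → F < η → 1 ≤ deriv φ F * G) (hG : G ≤ C * (s' + s))
    (hc : c * s' ^ 2 ≤ p - p') :
    c * s' ^ 2 ≤ (C + 2 * √a) * ((φ p + √p) - (φ p' + √p')) * (s' + s) := by
  have hp : 0 < p := hp'.trans_le hpp
  have hpI : p ∈ Ioo 0 η := ⟨hp, by linarith⟩
  have hp'I : p' ∈ Ioo 0 η := ⟨hp', by linarith⟩
  have hφ := hconc.le_add_deriv_mul_sub (Ioo_subset_Ico_self hpI) (Ioo_subset_Ico_self hp'I)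
    (hder p hpI)
  have hφ0 : 0 ≤ deriv φ p * (p - p') := mul_nonneg (hpos p hpI).le (sub_nonneg.2 hpp)
  have hφ1 : deriv φ p * (p - p') ≤ φ p - φ p' := by linarith
  have hq : √p' ≤ √p := Real.sqrt_le_sqrt hpp
  have hΔ0 : 0 ≤ φ p - φ p' := hφ0.trans hφ1
  have hΔ1 : 0 ≤ √p - √p' := sub_nonneg.2 hq
  have hss : 0 ≤ s' + s := by positivity
  have hsum : (C + 2 * √a) * ((φ p + √p) - (φ p' + √p')) * (s' + s)
      = C * (φ p - φ p') * (s' + s) + 2 * √a * (√p - √p') * (s' + s)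
        + (C * (√p - √p') * (s' + s) + 2 * √a * (φ p - φ p') * (s' + s)) := by ring
  have hn1 : 0 ≤ C * (φ p - φ p') * (s' + s) := by positivity
  have hn2 : 0 ≤ 2 * √a * (√p - √p') * (s' + s) := by positivity
  have hn3 : 0 ≤ C * (√p - √p') * (s' + s) := by positivity
  have hn4 : 0 ≤ 2 * √a * (φ p - φ p') * (s' + s) := by positivity
  refine hc.trans ?_
  rcases le_or_gt p F with hpF | hpF
  · have hFη : F < η := by nlinarith [mul_nonneg ha (sq_nonneg s)]
    have hFI : F ∈ Ioo 0 η := ⟨hp.trans_le hpF, hFη⟩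
    have hmono : deriv φ F ≤ deriv φ p := by
      rcases hpF.eq_or_lt with h | h
      · rw [h]
      · have h1 := hconc.le_add_deriv_mul_sub (Ioo_subset_Ico_self hpI)
          (Ioo_subset_Ico_self hFI) (hder p hpI)
        have h2 := hconc.le_add_deriv_mul_sub (Ioo_subset_Ico_self hFI)
          (Ioo_subset_Ico_self hpI) (hder F hFI)
        nlinarith
    have h1 : 1 ≤ deriv φ p * (C * (s' + s)) :=
      calc 1 ≤ deriv φ F * G := hPLK hFI.1 hFη
        _ ≤ deriv φ F * (C * (s' + s)) := mul_le_mul_of_nonneg_left hG (hpos F hFI).le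
        _ ≤ _ := mul_le_mul_of_nonneg_right hmono (by positivity)
    have h2 := mul_le_mul_of_nonneg_left h1 (sub_nonneg.2 hpp)
    have h3 := mul_le_mul_of_nonneg_right hφ1 (by positivity : 0 ≤ C * (s' + s))
    linarith
  · have h1 : √p ≤ √a * s := by
      refine Real.sqrt_le_iff.2 ⟨by positivity, ?_⟩
      rw [mul_pow, Real.sq_sqrt ha]
      linarith
    have h2 : p - p' = (√p - √p') * (√p + √p') := by
      have e1 := Real.mul_self_sqrt hp.le
      have e2 := Real.mul_self_sqrt hp'.le
      linarith
    have h3 : √p + √p' ≤ 2 * √a * (s' + s) := by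
      have := mul_nonneg (Real.sqrt_nonneg a) hs'
      linarith
    have h4 := mul_le_mul_of_nonneg_left h3 hΔ1
    linarith

/-- Convergence of a sequence under the PLK condition for `f`, when the merit function `f` plus a
multiple of the squared step decreases sufficiently. -/
lemma PLKCondition.tendsto_of_merit_decrease {n : ℕ} {f : EuclideanSpace ℝ (Fin n) → ℝ}
    {xb : EuclideanSpace ℝ (Fin n)} (hPLK : PLKCondition f xb)
    {y d : ℕ → EuclideanSpace ℝ (Fin n)} {p : ℕ → ℝ} {a c C : ℝ} (ha : 0 ≤ a) (hc : 0 < c)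
    (hC : 0 ≤ C) (hy : ∀ k, y (k + 1) = y k + d (k + 1)) (hd : Tendsto d atTop (nhds 0))
    (hcl : MapClusterPt xb atTop y) (hp : Tendsto p atTop (nhds 0)) (hp0 : ∀ k, 0 < p k)
    (hfp : ∀ k, f (y k) - f xb = 2 * p k - a * ‖d k‖ ^ 2)
    (hdec : ∀ k, c * ‖d (k + 1)‖ ^ 2 ≤ p k - p (k + 1))
    (hgrad : ∀ k, ‖gradient f (y k)‖ ≤ C * (‖d (k + 1)‖ + ‖d k‖)) :
    Tendsto y atTop (nhds xb) := by
  obtain ⟨η, U, φ, hη, hU, -, hφ0, hconc, hder, -, hpos, hineq⟩ := hPLK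
  obtain ⟨r, hr, hrU⟩ := Metric.mem_nhds_iff.1 hU
  obtain ⟨K, hK⟩ := eventually_atTop.1 (hp.eventually (gt_mem_nhds (half_pos hη)))
  have hanti : ∀ k, p (k + 1) ≤ p k := fun k => by
    have := hdec k
    have : 0 ≤ c * ‖d (k + 1)‖ ^ 2 := by positivity
    linarith
  have hI : ∀ k, K ≤ k → p k ∈ Ioo 0 η := fun k hk => ⟨hp0 k, by linarith [hK k hk]⟩
  set u : ℕ → ℝ := fun k => φ (p k) + √(p k) with hu
  have huanti : ∀ k, K ≤ k → u (k + 1) ≤ u k := by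
    intro k hk
    have h1 := hconc.le_add_deriv_mul_sub (Ioo_subset_Ico_self (hI k hk))
      (Ioo_subset_Ico_self (hI (k + 1) (by omega))) (hder _ (hI k hk))
    have h2 := mul_nonneg (hpos _ (hI k hk)).le (sub_nonneg.2 (hanti k))
    have h3 := Real.sqrt_le_sqrt (hanti k)
    simp only [hu]
    linarith
  have huK : Antitone fun k => u (k + K) := antitone_nat_of_succ_le fun k => by
    have := huanti (k + K) (by omega)
    rwa [add_right_comm] at this
  have hbdd : BddBelow (range fun k => u (k + K)) := by
    refine ⟨0, ?_⟩
    rintro _ ⟨k, rfl⟩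
    exact add_nonneg (hφ0 _ (Ioo_subset_Ico_self (hI _ (by omega)))) (Real.sqrt_nonneg _)
  refine tendsto_of_mapClusterPt_of_step_le (K₀ := K) (M := 3 * ((C + 2 * √a) / c)) hr
    (by positivity) hy hd ((tendsto_add_atTop_iff_nat K).1 (tendsto_atTop_ciInf huK hbdd))
    (fun k hk => ?_) hcl fun k hk hyk => ?_
  · have := ciInf_le hbdd (k - K)
    simpa [Nat.sub_add_cancel hk] using this
  · have h1 := mul_sq_le_of_desingularizing hconc hder hpos (hp0 (k + 1)) (hanti k)
      (by linarith [hK k hk]) ha hC (norm_nonneg (d k)) (norm_nonneg (d (k + 1))) (hfp k)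
      (fun h1 h2 => hineq _ (hrU (by rwa [Metric.mem_ball, dist_eq_norm])) (by linarith)
        (by linarith)) (hgrad k) (hdec k)
    have h2 := le_three_mul_add_half (D := (C + 2 * √a) / c * (u k - u (k + 1)))
      (norm_nonneg (d (k + 1))) (norm_nonneg (d k))
      (mul_nonneg (by positivity) (sub_nonneg.2 (huanti k hk))) (by
        rw [div_mul_eq_mul_div, div_mul_eq_mul_div, le_div_iff₀ hc]
        linarith)
    linarith

/-- Global convergence of the sharpness-aware minimization with momentum (SAMm). -/
theorem SAMm_global_convergence {n : ℕ}
    (f : EuclideanSpace ℝ (Fin n) → ℝ)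
    (hdiff : Differentiable ℝ f)
    (L : ℝ) (hL : 0 < L)
    (hlip : ∀ x y : EuclideanSpace ℝ (Fin n),
      ‖gradient f x - gradient f y‖ ≤ L * ‖x - y‖)
    (ν τ₁ τ₂ βbar δbar : ℝ) (hν : ν ∈ Set.Ioo (0:ℝ) 1)
    (hτ₁ : 0 < τ₁) (hτ₂ : 0 < τ₂) (hτ₂' : τ₂ ≤ ν / (L * (ν + 1)))
    (hparam : max (L*τ₁) (2*L*τ₁*δbar + (L*τ₁+1)*βbar^2) < 1 - ν)
    (β γ : ℕ → ℝ) (hβnn : ∀ k, 0 ≤ β k) (hγnn : ∀ k, 0 ≤ γ k)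
    (hβbar : ∀ k, β k ≤ βbar) (hβbar1 : βbar < 1)
    (hδbar : ∀ k, |β k - γ k| ≤ δbar)
    (x xin xex : ℕ → EuclideanSpace ℝ (Fin n))
    (hx01 : x 0 = x 1)
    (hxin : ∀ k, 1 ≤ k → xin k = x k + β k • (x k - x (k-1)))
    (hxex : ∀ k, 1 ≤ k → xex k = x k + γ k • (x k - x (k-1)))
    (hupd : ∀ k, 1 ≤ k →
      x (k+1) = xin k - τ₁ • gradient f (xex k + τ₂ • gradient f (xex k)))
    (hbdd : ∃ m : ℝ, ∀ k, m ≤ f (x k)) :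
    Tendsto (fun k => gradient f (x k)) atTop (nhds 0) ∧
    ∀ xb : EuclideanSpace ℝ (Fin n),
      (∀ k, 1 ≤ k → gradient f (xex k) ≠ 0) →
      PLKCondition f xb →
      MapClusterPt xb atTop x →
      Tendsto x atTop (nhds xb) ∧ gradient f xb = 0 := by
  obtain ⟨m, hm⟩ := hbdd
  obtain ⟨hν0, hν1⟩ := hν
  obtain ⟨hp1, hp2⟩ := max_lt_iff.1 hparam
  have hG : ∀ z, HasGradientAt f (gradient f z) z := fun z => (hdiff z).hasGradientAt
  have hδ0 : 0 ≤ δbar := (abs_nonneg _).trans (hδbar 0)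
  have hβ0 : 0 ≤ βbar := (hβnn 0).trans (hβbar 0)
  set d : ℕ → EuclideanSpace ℝ (Fin n) := fun k => x (k + 1) - x k with hd
  set e : ℕ → EuclideanSpace ℝ (Fin n) := fun k => gradient f (xex (k + 1))
  set g : ℕ → EuclideanSpace ℝ (Fin n) := fun k =>
    gradient f (xex (k + 1) + τ₂ • gradient f (xex (k + 1)))
  have hin : ∀ k, xin (k + 1) = x (k + 1) + β (k + 1) • d k := fun k => hxin (k + 1) (by omega)
  have hex : ∀ k, xex (k + 1) = x (k + 1) + γ (k + 1) • d k := fun k => hxex (k + 1) (by omega)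
  have hx : ∀ k, x (k + 2) = x (k + 1) + β (k + 1) • d k - τ₁ • g k := fun k => by
    rw [← hin]; exact hupd (k + 1) (by omega)
  have hdstep : ∀ k, d (k + 1) = β (k + 1) • d k - τ₁ • g k := fun k => by
    have h1 : d (k + 1) = x (k + 2) - x (k + 1) := rfl
    rw [h1, hx]; abel
  have hge : ∀ k, ‖g k - e k‖ ≤ ν * ‖g k‖ := fun k => by
    refine norm_sub_le_mul_norm_of_perturbed hL hν0 hτ₂' ((hlip _ _).trans_eq ?_)
    rw [add_sub_cancel_left, norm_smul, Real.norm_of_nonneg hτ₂.le]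
  have herr : ∀ k, ‖gradient f (x (k + 1) + β (k + 1) • d k) - g k‖
      ≤ L * δbar * ‖d k‖ + ν * ‖g k‖ := fun k => by
    have h1 : ‖gradient f (x (k + 1) + β (k + 1) • d k) - e k‖ ≤ L * δbar * ‖d k‖ := by
      refine (hlip _ _).trans ?_
      rw [hex, add_sub_add_left_eq_sub, ← sub_smul, norm_smul, Real.norm_eq_abs, mul_assoc]
      gcongr
      exact hδbar _
    refine (norm_sub_le_norm_sub_add_norm_sub _ (e k) _).trans (add_le_add h1 ?_)
    rw [norm_sub_rev]
    exact hge k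
  set A : ℝ := (1 + L * τ₁) * βbar ^ 2 + τ₁ * (L * δbar) with hA
  have hA0 : 0 ≤ A := by positivity
  set c : ℝ := 1 - ν - τ₁ * (L * δbar) - A with hc
  have hc0 : 0 < c := by rw [hc, hA]; linarith
  set V : ℕ → ℝ := fun k => 2 * τ₁ * f (x (k + 1)) + A * ‖d k‖ ^ 2 with hV
  have hVdec' : ∀ k, c * ‖d (k + 1)‖ ^ 2 + τ₁ ^ 2 * (1 - ν - L * τ₁) * ‖g k‖ ^ 2
      ≤ V k - V (k + 1) := fun k => by
    have h1 := momentum_step_descent_s17 hG hlip hτ₁.le hν0.le (by positivity) (herr k)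
    rw [← hx, ← hdstep] at h1
    have h2 : ((1 + L * τ₁) * β (k + 1) ^ 2 + τ₁ * (L * δbar)) * ‖d k‖ ^ 2 ≤ A * ‖d k‖ ^ 2 := by
      rw [hA]
      gcongr
      · exact hβnn _
      · exact hβbar _
    have h3 : V (k + 1) = 2 * τ₁ * f (x (k + 2)) + A * ‖d (k + 1)‖ ^ 2 := rfl
    have h4 : V k = 2 * τ₁ * f (x (k + 1)) + A * ‖d k‖ ^ 2 := rfl
    rw [h3, h4, hc]
    linarith
  have hg2 : 0 < τ₁ ^ 2 * (1 - ν - L * τ₁) := mul_pos (by positivity) (by linarith)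
  have hVdec : ∀ k, c * ‖d (k + 1)‖ ^ 2 ≤ V k - V (k + 1) := fun k =>
    (le_add_of_nonneg_right (mul_nonneg hg2.le (sq_nonneg _))).trans (hVdec' k)
  have hVanti : Antitone V := antitone_nat_of_succ_le fun k => by
    have := hVdec k
    have : 0 ≤ c * ‖d (k + 1)‖ ^ 2 := by positivity
    linarith
  have hVbdd : BddBelow (range V) := by
    refine ⟨2 * τ₁ * m, ?_⟩
    rintro _ ⟨k, rfl⟩
    have h1 := mul_le_mul_of_nonneg_left (hm (k + 1)) (by positivity : 0 ≤ 2 * τ₁)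
    have : 0 ≤ A * ‖d k‖ ^ 2 := by positivity
    simp only [hV]
    linarith
  obtain ⟨l, hl, hlV⟩ : ∃ l, Tendsto V atTop (nhds l) ∧ ∀ k, l ≤ V k :=
    ⟨_, tendsto_atTop_ciInf hVanti hVbdd, ciInf_le hVbdd⟩
  have hd0 : Tendsto d atTop (nhds 0) := (tendsto_add_atTop_iff_nat 1).1
    (tendsto_zero_of_mul_sq_le_sub hc0 hl hVdec)
  set C : ℝ := (1 + ν) / τ₁ + L * (βbar + δbar) with hC
  have hC0 : 0 ≤ C := by positivity
  have hgrad : ∀ k, ‖gradient f (x (k + 1))‖ ≤ C * (‖d (k + 1)‖ + ‖d k‖) := fun k => by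
    have h1 : ‖gradient f (x (k + 1)) - e k‖ ≤ L * (βbar + δbar) * ‖d k‖ := by
      refine (hlip _ _).trans ?_
      rw [hex, sub_add_cancel_left, norm_neg, norm_smul, Real.norm_of_nonneg (hγnn _), mul_assoc]
      gcongr
      linarith [(abs_le.1 (hδbar (k + 1))).1, hβbar (k + 1)]
    have h2 : ‖gradient f (x (k + 1))‖ ≤ ‖gradient f (x (k + 1)) - e k‖ + ‖e k‖ :=
      norm_le_norm_sub_add _ _
    have h3 : ‖e k‖ ≤ ‖g k - e k‖ + ‖g k‖ := by
      rw [norm_sub_rev]; exact norm_le_norm_sub_add _ _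
    have h4 : ‖g k‖ ≤ (‖d (k + 1)‖ + ‖d k‖) / τ₁ := by
      rw [le_div_iff₀ hτ₁]
      have h5 : τ₁ • g k = β (k + 1) • d k - d (k + 1) := by rw [hdstep]; abel
      have h6 := norm_sub_le (β (k + 1) • d k) (d (k + 1))
      rw [← h5, norm_smul, norm_smul, Real.norm_of_nonneg hτ₁.le,
        Real.norm_of_nonneg (hβnn _)] at h6
      have h7 := mul_le_mul_of_nonneg_right ((hβbar (k + 1)).trans hβbar1.le) (norm_nonneg (d k))
      linarith
    have h5 := mul_le_mul_of_nonneg_left h4 (by positivity : 0 ≤ 1 + ν)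
    have h6 : 0 ≤ L * (βbar + δbar) * ‖d (k + 1)‖ := by positivity
    have h7 : C * (‖d (k + 1)‖ + ‖d k‖) = (1 + ν) * ((‖d (k + 1)‖ + ‖d k‖) / τ₁)
        + L * (βbar + δbar) * ‖d (k + 1)‖ + L * (βbar + δbar) * ‖d k‖ := by rw [hC]; ring
    linarith [hge k]
  have hgrad0 : Tendsto (fun k => gradient f (x k)) atTop (nhds 0) := by
    refine (tendsto_add_atTop_iff_nat 1).1 (squeeze_zero_norm hgrad ?_)
    simpa using (((tendsto_add_atTop_iff_nat 1).2 hd0).norm.add hd0.norm).const_mul C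
  refine ⟨hgrad0, fun xb hne hPLK hcl => ?_⟩
  have hgcont : Continuous (gradient f) :=
    (LipschitzWith.of_dist_le' fun y z => by
      simpa only [dist_eq_norm] using hlip y z).continuous
  have hg0 : ∀ k, 0 < ‖g k‖ := fun k => by
    refine norm_pos_iff.2 fun h0 => hne (k + 1) (by omega) ?_
    have := hge k
    rw [h0, zero_sub, norm_neg, norm_zero, mul_zero] at this
    exact norm_le_zero_iff.1 this
  have hlt : ∀ k, l < V k := fun k => by
    have h1 := mul_pos hg2 (pow_pos (hg0 k) 2)
    have h2 : 0 ≤ c * ‖d (k + 1)‖ ^ 2 := by positivity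
    linarith [hVdec' k, hlV (k + 1)]
  have hcl' : MapClusterPt xb atTop fun k => x (k + 1) := by
    have h1 : map (fun k => x (k + 1)) atTop = map x atTop := by
      conv_rhs => rw [← map_add_atTop_eq_nat 1, map_map]
      rfl
    rw [MapClusterPt, h1]
    exact hcl
  have hfl : 2 * τ₁ * f xb = l := by
    have h1 : Tendsto (fun k => 2 * τ₁ * f (x (k + 1))) atTop (nhds l) := by
      have := hl.sub ((hd0.norm.pow 2).const_mul A)
      simpa [hV] using this
    have h2 : MapClusterPt (2 * τ₁ * f xb) atTop fun k => 2 * τ₁ * f (x (k + 1)) :=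
      hcl'.continuousAt_comp (f := fun z => 2 * τ₁ * f z)
        (hdiff.continuous.const_mul _).continuousAt
    exact eq_of_nhds_neBot (ClusterPt.mono h2 h1)
  have hxb : Tendsto x atTop (nhds xb) := by
    refine (tendsto_add_atTop_iff_nat 1).1 (hPLK.tendsto_of_merit_decrease
      (p := fun k => (V k - l) / (4 * τ₁)) (a := A / (2 * τ₁)) (c := c / (4 * τ₁))
      (by positivity) (by positivity) hC0 (fun k => ?_) hd0 hcl' ?_ (fun k => ?_) (fun k => ?_)
      (fun k => ?_) hgrad)
    · simp [hd]
    · simpa using (hl.sub_const l).div_const (4 * τ₁)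
    · exact div_pos (sub_pos.2 (hlt k)) (by positivity)
    · rw [← hfl]
      simp only [hV]
      field_simp
      ring
    · rw [← sub_div, div_mul_eq_mul_div]
      gcongr
      linarith [hVdec k]
  exact ⟨hxb, tendsto_nhds_unique ((hgcont.tendsto xb).comp hxb) hgrad0⟩
end
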